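/- Let f(x,y) ∈ ℝ[x,y] be a non-degenerate polynomial of total degree k ≥ 2. Then there exists a constant c > 0 depending only on k such that for every finite set A ⊆ ℝ one has max(|A+A|, |f(A,A)|) ≥ c·|A|^{5/4}. -/

import Mathlib

open Finset Pointwise

/-- A polynomial `f(x,y) ∈ ℝ[x,y]` is degenerate if it can be written as
`Q(L(x,y))` where `Q` is a one-variable real polynomial and `L` is a linear
form in `x` and `y`. -/
def IsDegenerate (f : MvPolynomial (Fin 2) ℝ) : Prop :=
  ∃ (Q : Polynomial ℝ) (a b : ℝ), ∀ x y : ℝ,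
    MvPolynomial.eval ![x, y] f = Q.eval (a * x + b * y)

/-- `g` is a real polynomial function of degree at most `K`. -/
def IsPolyFun (K : ℕ) (g : ℝ → ℝ) : Prop :=
  ∃ P : Polynomial ℝ, P.natDegree ≤ K ∧ ∀ x, g x = P.eval x

namespace IsPolyFun

variable {K L : ℕ} {g h : ℝ → ℝ}

lemma mono (hg : IsPolyFun K g) (hKL : K ≤ L) : IsPolyFun L g := by
  obtain ⟨P, hP, hPg⟩ := hg
  exact ⟨P, hP.trans hKL, hPg⟩

lemma const (c : ℝ) : IsPolyFun 0 fun _ => c :=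
  ⟨Polynomial.C c, by simp, by simp⟩

lemma id : IsPolyFun 1 fun x => x :=
  ⟨Polynomial.X, by simp, by simp⟩

lemma add (hg : IsPolyFun K g) (hh : IsPolyFun K h) : IsPolyFun K fun x => g x + h x := by
  obtain ⟨P, hP, hPg⟩ := hg
  obtain ⟨Q, hQ, hQh⟩ := hh
  exact ⟨P + Q, Polynomial.natDegree_add_le_of_degree_le hP hQ, by simp [hPg, hQh]⟩

lemma sub (hg : IsPolyFun K g) (hh : IsPolyFun K h) : IsPolyFun K fun x => g x - h x := by
  obtain ⟨P, hP, hPg⟩ := hg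
  obtain ⟨Q, hQ, hQh⟩ := hh
  exact ⟨P - Q, Polynomial.natDegree_sub_le_of_le hP hQ |>.trans (by simp), by simp [hPg, hQh]⟩

lemma mul (hg : IsPolyFun K g) (hh : IsPolyFun L h) :
    IsPolyFun (K + L) fun x => g x * h x := by
  obtain ⟨P, hP, hPg⟩ := hg
  obtain ⟨Q, hQ, hQh⟩ := hh
  exact ⟨P * Q, Polynomial.natDegree_mul_le_of_le hP hQ, by simp [hPg, hQh]⟩

lemma pow (hg : IsPolyFun K g) (n : ℕ) : IsPolyFun (n * K) fun x => g x ^ n := by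
  obtain ⟨P, hP, hPg⟩ := hg
  exact ⟨P ^ n, Polynomial.natDegree_pow_le_of_le n hP, by simp [hPg]⟩

lemma sum {ι : Type*} (s : Finset ι) {g : ι → ℝ → ℝ} (hg : ∀ i ∈ s, IsPolyFun K (g i)) :
    IsPolyFun K fun x => ∑ i ∈ s, g i x := by
  choose! P hP hPg using hg
  refine ⟨∑ i ∈ s, P i, Polynomial.natDegree_sum_le_of_forall_le s P hP, fun x => ?_⟩
  rw [Polynomial.eval_finsetSum]
  exact Finset.sum_congr rfl fun i hi => hPg i hi x

lemma comp_add (hg : IsPolyFun K g) (d : ℝ) : IsPolyFun K fun x => g (x + d) := by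
  obtain ⟨P, hP, hPg⟩ := hg
  exact ⟨P.comp (Polynomial.X + Polynomial.C d), by simpa [Polynomial.natDegree_comp] using hP,
    by simp [hPg]⟩

lemma continuous (hg : IsPolyFun K g) : Continuous g := by
  obtain ⟨P, -, hPg⟩ := hg
  rw [show g = fun x => P.eval x from funext hPg]
  exact P.continuous

lemma eq_zero (hg : IsPolyFun K g) {S : Finset ℝ} (hS : ∀ x ∈ S, g x = 0) (hK : K < #S)
    (x : ℝ) : g x = 0 := by
  obtain ⟨P, hP, hPg⟩ := hg
  rw [hPg, Polynomial.eq_zero_of_natDegree_lt_card_of_eval_eq_zero' P S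
    (fun y hy => (hPg y).symm.trans (hS y hy)) (hP.trans_lt hK), Polynomial.eval_zero]

lemma card_le (hg : IsPolyFun K g) {S : Finset ℝ} (hS : ∀ x ∈ S, g x = 0) {z : ℝ}
    (hz : g z ≠ 0) : #S ≤ K := by
  by_contra! hK
  exact hz (hg.eq_zero hS hK z)

end IsPolyFun

/-- A relation `∑ c (i, j, l) x ^ i F ^ j G ^ l = 0` with few exponents. -/
lemma exists_algebraic_relation {K : ℕ} (hK : 1 ≤ K) {F G : ℝ → ℝ → ℝ}
    (hF₁ : ∀ y, IsPolyFun K fun x => F x y) (hF₂ : ∀ x, IsPolyFun K (F x))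
    (hG₁ : ∀ y, IsPolyFun K fun x => G x y) (hG₂ : ∀ x, IsPolyFun K (G x)) :
    ∃ c : Fin (K * (16 * K + 1)) × Fin (16 * K + 1) × Fin (16 * K + 1) → ℝ, c ≠ 0 ∧
      ∀ x y, ∑ i, c i * (x ^ (i.1 : ℕ) * F x y ^ (i.2.1 : ℕ) * G x y ^ (i.2.2 : ℕ)) = 0 := by
  set q := 16 * K + 1 with hq
  set N := 3 * (K * q) with hN
  let B : Matrix (Fin (N + 1) × Fin (N + 1)) (Fin (K * q) × Fin q × Fin q) ℝ :=
    fun p i => ((p.1 : ℕ) : ℝ) ^ (i.1 : ℕ) * F (p.1 : ℕ) (p.2 : ℕ) ^ (i.2.1 : ℕ) *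
      G (p.1 : ℕ) (p.2 : ℕ) ^ (i.2.2 : ℕ)
  have hker : LinearMap.ker B.mulVecLin ≠ ⊥ := by
    apply LinearMap.ker_ne_bot_of_finrank_lt
    simp only [Module.finrank_fintype_fun_eq_card, Fintype.card_prod, Fintype.card_fin]
    have h1 : N + 1 ≤ 4 * (K * q) := by nlinarith
    calc (N + 1) * (N + 1) ≤ (4 * (K * q)) * (4 * (K * q)) := Nat.mul_le_mul h1 h1
      _ = (16 * K) * (K * q * q) := by ring
      _ < q * (K * q * q) := by
        apply Nat.mul_lt_mul_of_pos_right (by omega)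
        positivity
      _ = K * q * (q * q) := by ring
  obtain ⟨c, hc, hc0⟩ := Submodule.exists_mem_ne_zero_of_ne_bot hker
  refine ⟨c, hc0, ?_⟩
  set Φ : ℝ → ℝ → ℝ := fun x y =>
    ∑ i, c i * (x ^ (i.1 : ℕ) * F x y ^ (i.2.1 : ℕ) * G x y ^ (i.2.2 : ℕ)) with hΦ
  have hdeg (i : Fin (K * q) × Fin q × Fin q) :
      0 + ((i.1 : ℕ) * 1 + (i.2.1 : ℕ) * K + (i.2.2 : ℕ) * K) ≤ N := by
    have h1 := i.1.2
    have h2 : (i.2.1 : ℕ) * K ≤ q * K := Nat.mul_le_mul_right _ i.2.1.2.le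
    have h3 : (i.2.2 : ℕ) * K ≤ q * K := Nat.mul_le_mul_right _ i.2.2.2.le
    nlinarith
  have h₁ (y : ℝ) : IsPolyFun N fun x => Φ x y :=
    IsPolyFun.sum _ fun i _ => ((IsPolyFun.const (c i)).mul
      (((IsPolyFun.id.pow _).mul ((hF₁ y).pow _)).mul ((hG₁ y).pow _))).mono (hdeg i)
  have h₂ (x : ℝ) : IsPolyFun N (Φ x) :=
    IsPolyFun.sum _ fun i _ => ((IsPolyFun.const (c i)).mul
      ((((IsPolyFun.const (x ^ (i.1 : ℕ)))).mul ((hF₂ x).pow _)).mul ((hG₂ x).pow _))).mono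
      (by have := hdeg i; omega)
  have hgrid (p r : ℕ) (hp : p < N + 1) (hr : r < N + 1) : Φ p r = 0 := by
    have := congrFun (LinearMap.mem_ker.mp hc) (⟨p, hp⟩, ⟨r, hr⟩)
    rw [Matrix.mulVecLin_apply] at this
    simpa [Matrix.mulVec, dotProduct, B, hΦ, mul_comm] using this
  let S : Finset ℝ := (range (N + 1)).image (fun n : ℕ => (n : ℝ))
  have hS : N < #S := by
    rw [card_image_of_injective _ Nat.cast_injective, card_range]; omega
  intro x y
  refine (h₂ x).eq_zero (S := S) (fun r' hr' => ?_) hS y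
  obtain ⟨r, hr, rfl⟩ := mem_image.mp hr'
  refine (h₁ r).eq_zero (S := S) (fun p' hp' => ?_) hS x
  obtain ⟨p, hp, rfl⟩ := mem_image.mp hp'
  exact hgrid p r (mem_range.mp hp) (mem_range.mp hr)

/-- `(F₁, F₂)` is the gradient of `F`, tested along lines. -/
def HasGradient (F F₁ F₂ : ℝ → ℝ → ℝ) : Prop :=
  ∀ x y v w, HasDerivAt (fun ε => F (x + ε * v) (y + ε * w)) (v * F₁ x y + w * F₂ x y) 0

lemma HasGradient.swap {F F₁ F₂ : ℝ → ℝ → ℝ} (h : HasGradient F F₁ F₂) :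
    HasGradient (fun x y => F y x) (fun x y => F₂ y x) (fun x y => F₁ y x) := by
  intro x y v w
  simpa [add_comm] using h y x w v

lemma card_image_fst_nonsingular_zeros_le {K : ℕ} (hK : 1 ≤ K) {F F₁ F₂ G G₁ G₂ : ℝ → ℝ → ℝ}
    (hF₁ : ∀ y, IsPolyFun K fun x => F x y) (hF₂ : ∀ x, IsPolyFun K (F x))
    (hG₁ : ∀ y, IsPolyFun K fun x => G x y) (hG₂ : ∀ x, IsPolyFun K (G x))
    (hF : HasGradient F F₁ F₂) (hG : HasGradient G G₁ G₂) (Z : Finset (ℝ × ℝ))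
    (hZ : ∀ z ∈ Z, F z.1 z.2 = 0 ∧ G z.1 z.2 = 0 ∧
      F₁ z.1 z.2 * G₂ z.1 z.2 - F₂ z.1 z.2 * G₁ z.1 z.2 ≠ 0) :
    #(Z.image Prod.fst) ≤ K * (16 * K + 1) := by
  have hrel := exists_algebraic_relation hK hF₁ hF₂ hG₁ hG₂
  generalize 16 * K + 1 = q at hrel ⊢
  obtain ⟨c, hc0, hc⟩ := hrel
  obtain ⟨i₁, hi₁⟩ := Function.ne_iff.mp hc0
  obtain ⟨⟨i₀, j₀, l₀⟩, hi₀, hmin⟩ := exists_min_image ({i | c i ≠ 0} : Finset _)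
    (fun i => (i.2.1 : ℕ) + (i.2.2 : ℕ)) ⟨i₁, by simpa using hi₁⟩
  simp only [mem_filter, mem_univ, true_and] at hi₀ hmin
  obtain ⟨m, hm⟩ : ∃ m, m = (j₀ : ℕ) + (l₀ : ℕ) := ⟨_, rfl⟩
  rw [← hm] at hmin
  let P : Polynomial ℝ := ∑ i : Fin (K * q), Polynomial.monomial (i : ℕ) (c (i, j₀, l₀))
  have hP0 : P ≠ 0 := by
    intro h
    apply hi₀
    have := congrArg (fun p => p.coeff (i₀ : ℕ)) h
    simpa [P, Polynomial.finsetSum_coeff, Polynomial.coeff_monomial, Fin.val_inj] using this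
  have hPdeg : P.natDegree ≤ K * q :=
    Polynomial.natDegree_sum_le_of_forall_le _ _ fun i _ =>
      (Polynomial.natDegree_monomial_le _).trans i.2.le
  by_contra! hcard
  apply hP0
  refine Polynomial.eq_zero_of_natDegree_lt_card_of_eval_eq_zero' P (Z.image Prod.fst) ?_
    (hPdeg.trans_lt hcard)
  intro x hx
  obtain ⟨⟨x, y⟩, hz, rfl⟩ := mem_image.mp hx
  obtain ⟨hFz, hGz, hJ⟩ := hZ _ hz
  simp only at hFz hGz hJ ⊢
  have key (t : ℝ) : ∑ i, c i * (x ^ (i.1 : ℕ) * 1 ^ (i.2.1 : ℕ) * t ^ (i.2.2 : ℕ) *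
      0 ^ ((i.2.1 : ℕ) + (i.2.2 : ℕ) - m)) = 0 := by
    set J := F₁ x y * G₂ x y - F₂ x y * G₁ x y with hJdef
    obtain ⟨v, w, hv, hw⟩ : ∃ v w, v * F₁ x y + w * F₂ x y = 1 ∧ v * G₁ x y + w * G₂ x y = t := by
      refine ⟨(G₂ x y - t * F₂ x y) / J, (t * F₁ x y - G₁ x y) / J, ?_, ?_⟩ <;>
      · field_simp
        rw [hJdef]
        ring
    have hFd := (hasDerivAt_iff_tendsto_slope_zero.mp (hF x y v w))
    have hGd := (hasDerivAt_iff_tendsto_slope_zero.mp (hG x y v w))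
    simp only [zero_add, zero_mul, add_zero, hFz, hGz, sub_zero, smul_eq_mul, hv, hw] at hFd hGd
    have hid : Filter.Tendsto (fun ε : ℝ => ε) (nhdsWithin 0 {0}ᶜ) (nhds 0) :=
      Filter.tendsto_id.mono_left nhdsWithin_le_nhds
    have hxd : Filter.Tendsto (fun ε : ℝ => x + ε * v) (nhdsWithin 0 {0}ᶜ) (nhds x) := by
      simpa using (hid.mul_const v).const_add x
    have hlim := tendsto_finsetSum (univ : Finset (Fin (K * q) × Fin q × Fin q)) fun i _ =>
      ((((hxd.pow (i.1 : ℕ)).mul (hFd.pow (i.2.1 : ℕ))).mul (hGd.pow (i.2.2 : ℕ))).mul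
        (hid.pow ((i.2.1 : ℕ) + (i.2.2 : ℕ) - m))).const_mul (c i)
    refine tendsto_nhds_unique hlim (tendsto_const_nhds.congr' ?_)
    filter_upwards [self_mem_nhdsWithin] with ε hε
    have hε : ε ≠ 0 := hε
    have h0 := hc (x + ε * v) (y + ε * w)
    rw [← mul_zero ((ε ^ m)⁻¹), ← h0, mul_sum]
    refine sum_congr rfl fun i _ => ?_
    by_cases hci : c i = 0
    · simp [hci]
    · obtain ⟨e, he⟩ := Nat.exists_eq_add_of_le (hmin i hci)
      rw [he, Nat.add_sub_cancel_left]
      have hpow : (ε ^ m)⁻¹ = (ε⁻¹) ^ (i.2.1 : ℕ) * (ε⁻¹) ^ (i.2.2 : ℕ) * ε ^ e := by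
        rw [← pow_add, he, inv_pow, pow_add]
        have := pow_ne_zero e hε
        field_simp
      rw [hpow]
      ring
  let R : Polynomial ℝ := ∑ i : Fin (K * q) × Fin q × Fin q, Polynomial.monomial (i.2.2 : ℕ)
    (c i * x ^ (i.1 : ℕ) * 0 ^ ((i.2.1 : ℕ) + (i.2.2 : ℕ) - m))
  have hR : R = 0 := by
    refine Polynomial.funext fun t => ?_
    rw [Polynomial.eval_finsetSum, Polynomial.eval_zero]
    refine Eq.trans ?_ (key t)
    refine sum_congr rfl fun i _ => ?_
    rw [Polynomial.eval_monomial]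
    ring
  have hcoeff := congrArg (fun p => p.coeff (l₀ : ℕ)) hR
  simp only [R, Polynomial.finsetSum_coeff, Polynomial.coeff_monomial, Polynomial.coeff_zero,
    Fintype.sum_prod_type, Fin.val_inj, sum_ite_eq', mem_univ, if_true] at hcoeff
  rw [← hcoeff]
  simp only [P, Polynomial.eval_finsetSum, Polynomial.eval_monomial]
  refine sum_congr rfl fun i _ => ?_
  rw [sum_eq_single j₀]
  · simp [hm]
  · intro j _ hj
    by_cases hcj : c (i, j, l₀) = 0
    · simp [hcj]
    · have h1 := hmin _ hcj
      have h2 : (j : ℕ) ≠ j₀ := fun h => hj (Fin.ext h)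
      rw [zero_pow (by simp only at h1; omega), mul_zero]
  · simp

/-- A weak form of the theorem of Bézout for the nonsingular common zeros of two polynomials, which
may have a common factor. -/
lemma card_nonsingular_zeros_le {K : ℕ} (hK : 1 ≤ K) {F F₁ F₂ G G₁ G₂ : ℝ → ℝ → ℝ}
    (hF₁ : ∀ y, IsPolyFun K fun x => F x y) (hF₂ : ∀ x, IsPolyFun K (F x))
    (hG₁ : ∀ y, IsPolyFun K fun x => G x y) (hG₂ : ∀ x, IsPolyFun K (G x))
    (hF : HasGradient F F₁ F₂) (hG : HasGradient G G₁ G₂) (Z : Finset (ℝ × ℝ))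
    (hZ : ∀ z ∈ Z, F z.1 z.2 = 0 ∧ G z.1 z.2 = 0 ∧
      F₁ z.1 z.2 * G₂ z.1 z.2 - F₂ z.1 z.2 * G₁ z.1 z.2 ≠ 0) :
    #Z ≤ (K * (16 * K + 1)) ^ 2 := by
  have h₁ := card_image_fst_nonsingular_zeros_le hK hF₁ hF₂ hG₁ hG₂ hF hG Z hZ
  have h₂ := card_image_fst_nonsingular_zeros_le hK hF₂ hF₁ hG₂ hG₁ hF.swap hG.swap
    (Z.image Prod.swap) (by
      intro z' hz'
      obtain ⟨z, hz, rfl⟩ := mem_image.mp hz'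
      obtain ⟨a, b, h⟩ := hZ z hz
      exact ⟨a, b, fun h' => h (by simp only [Prod.fst_swap, Prod.snd_swap] at h'; linarith)⟩)
  rw [image_image] at h₂
  calc #Z ≤ #(Z.image Prod.fst ×ˢ Z.image Prod.snd) :=
        card_le_card fun z hz => mem_product.mpr ⟨mem_image_of_mem _ hz, mem_image_of_mem _ hz⟩
    _ = #(Z.image Prod.fst) * #(Z.image Prod.snd) := card_product _ _
    _ ≤ _ := by rw [sq]; exact Nat.mul_le_mul h₁ h₂

/-- The elements of `T` strictly between `u` and `v`. -/
noncomputable def between (T : Finset ℝ) (u v : ℝ) : Finset ℝ :=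
  {t ∈ T | (u < t ∧ t < v) ∨ (v < t ∧ t < u)}

lemma mem_between {T : Finset ℝ} {u v t : ℝ} :
    t ∈ between T u v ↔ t ∈ T ∧ ((u < t ∧ t < v) ∨ (v < t ∧ t < u)) := mem_filter

lemma card_near_left_le (A : Finset ℝ) (L : ℕ) (z : ℝ) :
    #{x ∈ A | x < z ∧ #(between A x z) ≤ L} ≤ L + 1 := by
  set B := {x ∈ A | x < z ∧ #(between A x z) ≤ L}
  rcases B.eq_empty_or_nonempty with h | h
  · simp [h]
  have hm := B.min'_mem h
  have hm' := (mem_filter.mp hm).2.2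
  have hsub : B.erase (B.min' h) ⊆ between A (B.min' h) z := by
    intro x hx
    have hxB := mem_filter.mp (mem_of_mem_erase hx)
    exact mem_between.mpr ⟨hxB.1, .inl ⟨B.min'_lt_of_mem_erase_min' h hx, hxB.2.1⟩⟩
  have := card_le_card hsub
  rw [card_erase_of_mem hm] at this
  omega

lemma card_near_right_le (A : Finset ℝ) (L : ℕ) (z : ℝ) :
    #{x ∈ A | z < x ∧ #(between A x z) ≤ L} ≤ L + 1 := by
  set B := {x ∈ A | z < x ∧ #(between A x z) ≤ L}
  rcases B.eq_empty_or_nonempty with h | h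
  · simp [h]
  have hm := B.max'_mem h
  have hm' := (mem_filter.mp hm).2.2
  have hsub : B.erase (B.max' h) ⊆ between A (B.max' h) z := by
    intro x hx
    have hxB := mem_filter.mp (mem_of_mem_erase hx)
    exact mem_between.mpr ⟨hxB.1, .inr ⟨hxB.2.1, B.lt_max'_of_mem_erase_max' h hx⟩⟩
  have := card_le_card hsub
  rw [card_erase_of_mem hm] at this
  omega

lemma card_few_above_le (A : Finset ℝ) (L : ℕ) : #{x ∈ A | #{y ∈ A | x < y} ≤ L} ≤ L + 1 := by
  set B := {x ∈ A | #{y ∈ A | x < y} ≤ L}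
  rcases B.eq_empty_or_nonempty with h | h
  · simp [h]
  have hm := B.min'_mem h
  have hm' := (mem_filter.mp hm).2
  have hsub : B.erase (B.min' h) ⊆ {y ∈ A | B.min' h < y} := fun x hx =>
    mem_filter.mpr ⟨(mem_filter.mp (mem_of_mem_erase hx)).1, B.min'_lt_of_mem_erase_min' h hx⟩
  have := card_le_card hsub
  rw [card_erase_of_mem hm] at this
  omega

lemma card_filter_product_le {α β : Type*} (s : Finset α) (t : Finset β) (p : α → β → Prop)
    [∀ a, DecidablePred (p a)] {C : ℕ} (h : ∀ a ∈ s, #{b ∈ t | p a b} ≤ C) :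
    #{z ∈ s ×ˢ t | p z.1 z.2} ≤ #s * C := by
  rw [card_filter, sum_product]
  calc _ = ∑ a ∈ s, #{b ∈ t | p a b} := by simp only [card_filter]
    _ ≤ #s * C := by simpa using sum_le_card_nsmul s _ C h

lemma card_near_pairs_le (T : Finset ℝ) (L : ℕ) :
    #{p ∈ T ×ˢ T | #(between T p.1 p.2) ≤ L} ≤ #T * (2 * L + 3) := by
  refine card_filter_product_le T T (fun s t => #(between T s t) ≤ L) fun s hs => ?_
  have hsub : {t ∈ T | #(between T s t) ≤ L} ⊆
      insert s ({t ∈ T | t < s ∧ #(between T t s) ≤ L} ∪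
        {t ∈ T | s < t ∧ #(between T t s) ≤ L}) := by
    intro t ht
    obtain ⟨htT, ht⟩ := mem_filter.mp ht
    have hcomm : between T t s = between T s t := by
      ext u
      simp only [mem_between]
      tauto
    rcases lt_trichotomy s t with h | h | h <;> simp [*]
  refine (card_le_card hsub).trans ((card_insert_le _ _).trans ?_)
  have h := card_union_le {t ∈ T | t < s ∧ #(between T t s) ≤ L}
    {t ∈ T | s < t ∧ #(between T t s) ≤ L}
  have h₁ := card_near_left_le T L s
  have h₂ := card_near_right_le T L s
  omega

/-- A near successor of `x` in `A` that satisfies a property failing rarely. -/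
lemma exists_near_succ {A : Finset ℝ} {r : ℝ → Prop} [DecidablePred r] {K : ℕ} {x : ℝ}
    (hr : #{y ∈ A | ¬ r y} ≤ K) (hx : K < #{y ∈ A | x < y}) :
    ∃ y ∈ A, x < y ∧ r y ∧ #(between A x y) ≤ K := by
  have hne : {y ∈ A | x < y ∧ r y}.Nonempty := by
    by_contra h
    rw [not_nonempty_iff_eq_empty, filter_eq_empty_iff] at h
    have hsub : {y ∈ A | x < y} ⊆ {y ∈ A | ¬ r y} := fun y hy => by
      obtain ⟨hyA, hxy⟩ := mem_filter.mp hy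
      exact mem_filter.mpr ⟨hyA, fun hry => h hyA ⟨hxy, hry⟩⟩
    exact absurd (card_le_card hsub) (by omega)
  obtain ⟨y, hy, hmin⟩ := exists_min_image _ (fun y => y) hne
  obtain ⟨hyA, hxy, hry⟩ := mem_filter.mp hy
  refine ⟨y, hyA, hxy, hry, (card_le_card fun z hz => ?_).trans hr⟩
  obtain ⟨hzA, hz⟩ := mem_between.mp hz
  refine mem_filter.mpr ⟨hzA, fun hrz => ?_⟩
  rcases hz with hz | hz
  · exact absurd (hmin z (mem_filter.mpr ⟨hzA, hz.1, hrz⟩)) (not_le.mpr hz.2)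
  · linarith [hz.1, hz.2]

lemma IsPolyFun.exists_fiber {K : ℕ} {g : ℝ → ℝ} (hg : IsPolyFun K g) {t z : ℝ} (hz : g z ≠ t) :
    ∃ R : Finset ℝ, #R ≤ K ∧ ∀ x, g x = t → x ∈ R := by
  obtain ⟨P, hP, hPg⟩ := hg
  have hne : P - Polynomial.C t ≠ 0 := fun h => hz (by
    have := congrArg (Polynomial.eval z) h
    simp only [Polynomial.eval_sub, Polynomial.eval_C, Polynomial.eval_zero] at this
    rw [hPg]
    linarith)
  refine ⟨(P - Polynomial.C t).roots.toFinset, (Multiset.toFinset_card_le _).trans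
    ((Polynomial.card_roots' _).trans (by simpa using hP)), fun x hx => ?_⟩
  simp [hne, ← hPg, hx]

lemma sum_card_between_le {K L : ℕ} {g : ℝ → ℝ} (hg : IsPolyFun K g) (T : Finset ℝ)
    {A X : Finset ℝ} (hXA : X ⊆ A) {σ : ℝ → ℝ}
    (hσ : ∀ x ∈ X, x < σ x ∧ #(between A x (σ x)) ≤ L) :
    ∑ x ∈ X, #(between T (g x) (g (σ x))) ≤ #T * (K * (L + 1)) := by
  have hswap : ∑ x ∈ X, #(between T (g x) (g (σ x))) =
      ∑ t ∈ T, #{x ∈ X | (g x < t ∧ t < g (σ x)) ∨ (g (σ x) < t ∧ t < g x)} := by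
    simp only [between, card_filter]
    exact sum_comm
  rw [hswap]
  refine (sum_le_card_nsmul T _ (K * (L + 1)) fun t _ => ?_).trans (by simp)
  set B := {x ∈ X | (g x < t ∧ t < g (σ x)) ∨ (g (σ x) < t ∧ t < g x)}
  rcases B.eq_empty_or_nonempty with h | ⟨x₀, hx₀⟩
  · simp [h]
  have hx₀' : g x₀ ≠ t := by
    rcases (mem_filter.mp hx₀).2 with h | h
    · exact h.1.ne
    · exact h.2.ne'
  obtain ⟨R, hRK, hR⟩ := hg.exists_fiber hx₀'
  have hsub : B ⊆ R.biUnion fun z => {x ∈ A | x < z ∧ #(between A x z) ≤ L} := by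
    intro x hx
    obtain ⟨hxX, hx⟩ := mem_filter.mp hx
    obtain ⟨hlt, hcard⟩ := hσ x hxX
    have hz : ∃ z ∈ Set.Ioo x (σ x), g z = t := by
      rcases hx with hx | hx
      · exact intermediate_value_Ioo hlt.le hg.continuous.continuousOn hx
      · exact intermediate_value_Ioo' hlt.le hg.continuous.continuousOn hx
    obtain ⟨z, hz, hgz⟩ := hz
    refine mem_biUnion.mpr ⟨z, hR z hgz, mem_filter.mpr ⟨hXA hxX, hz.1,
      (card_le_card fun y hy => ?_).trans hcard⟩⟩
    obtain ⟨hyA, hy⟩ := mem_between.mp hy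
    refine mem_between.mpr ⟨hyA, ?_⟩
    rcases hy with hy | hy
    · exact .inl ⟨hy.1, hy.2.trans hz.2⟩
    · linarith [hy.1, hy.2, hz.1]
  calc #B ≤ #R * (L + 1) := (card_le_card hsub).trans
        (card_biUnion_le_card_mul _ _ _ fun z _ => card_near_left_le A L z)
    _ ≤ K * (L + 1) := Nat.mul_le_mul_right _ hRK

lemma card_filter_lt_mul_le {α : Type*} (s : Finset α) (h : α → ℕ) (L : ℕ) :
    #{x ∈ s | L < h x} * (L + 1) ≤ ∑ x ∈ s, h x := by
  calc #{x ∈ s | L < h x} * (L + 1) ≤ ∑ x ∈ s with L < h x, h x := by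
        simpa using card_nsmul_le_sum {x ∈ s | L < h x} h (L + 1) fun x hx => (mem_filter.mp hx).2
    _ ≤ ∑ x ∈ s, h x := sum_le_sum_of_subset (filter_subset _ _)

lemma card_pow_five_le_of_jacobian_ne_zero {K : ℕ} (hK : 1 ≤ K) {f f₁ f₂ : ℝ → ℝ → ℝ}
    (hf : ∀ y, IsPolyFun K fun x => f x y) (hf' : ∀ x, IsPolyFun K (f x))
    (hf₁ : ∀ y, IsPolyFun K fun x => f₁ x y) (hf₁' : ∀ x, IsPolyFun K (f₁ x))
    (hf₂ : ∀ y, IsPolyFun K fun x => f₂ x y) (hf₂' : ∀ x, IsPolyFun K (f₂ x))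
    (hgrad : HasGradient f f₁ f₂) {x₁ x₂ y₀ : ℝ}
    (hW : f₁ x₁ y₀ * f₂ x₂ y₀ - f₂ x₁ y₀ * f₁ x₂ y₀ ≠ 0) {A : Finset ℝ} {M : ℕ}
    (hS : #(A + A) ≤ M) (hT : #(image₂ f A A) ≤ M) :
    #A ^ 5 ≤ (3200 * (K * (16 * K + 1)) ^ 2 * (K * (K + 1)) ^ 2 + 4 * (4 * K + 1)) * M ^ 4 := by
  set n := #A with hn
  set D := (K * (16 * K + 1)) ^ 2
  have hnM : n ≤ M := le_trans card_le_card_add_self hS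
  rcases lt_or_ge n (4 * (4 * K + 1)) with hsmall | hlarge
  · calc n ^ 5 = n * n ^ 4 := by ring
      _ ≤ (4 * (4 * K + 1)) * M ^ 4 := Nat.mul_le_mul hsmall.le (Nat.pow_le_pow_left hnM 4)
      _ ≤ _ := Nat.mul_le_mul_right _ (Nat.le_add_left _ _)
  set W : ℝ → ℝ → ℝ → ℝ := fun x x' y => f₁ x y * f₂ x' y - f₂ x y * f₁ x' y with hWdef
  have hW₁ (x' y : ℝ) : IsPolyFun K fun x => W x x' y :=
    ((hf₁ y).mul (IsPolyFun.const (f₂ x' y))).sub ((hf₂ y).mul (IsPolyFun.const (f₁ x' y)))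
  have hW₂ (x y : ℝ) : IsPolyFun K fun x' => W x x' y := by
    have h := ((hf₂ y).mul (IsPolyFun.const (f₁ x y))).sub
      ((hf₁ y).mul (IsPolyFun.const (f₂ x y)))
    simpa only [hWdef, mul_comm, add_zero] using h
  have hW₃ (x x' : ℝ) : IsPolyFun (K + K) (W x x') :=
    ((hf₁' x).mul (hf₂' x')).sub ((hf₂' x).mul (hf₁' x'))
  set X : Finset ℝ := {x ∈ A | W x x₂ y₀ ≠ 0 ∧ K < #{y ∈ A | x < y}} with hX
  have hXA : X ⊆ A := filter_subset _ _
  have hXcard : n ≤ #X + (2 * K + 1) := by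
    have hsub : A ⊆ X ∪ ({x ∈ A | W x x₂ y₀ = 0} ∪ {x ∈ A | #{y ∈ A | x < y} ≤ K}) := by
      intro x hx
      simp only [hX, mem_union, mem_filter, hx, true_and]
      rw [← not_lt]
      tauto
    have h₁ : #{x ∈ A | W x x₂ y₀ = 0} ≤ K :=
      (hW₁ x₂ y₀).card_le (fun x hx => (mem_filter.mp hx).2) hW
    have h₂ := card_few_above_le A K
    have h₃ := card_le_card hsub
    have h₄ := card_union_le X ({x ∈ A | W x x₂ y₀ = 0} ∪ {x ∈ A | #{y ∈ A | x < y} ≤ K})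
    have h₅ := card_union_le {x ∈ A | W x x₂ y₀ = 0} {x ∈ A | #{y ∈ A | x < y} ≤ K}
    omega
  have hsucc (x : ℝ) (hx : x ∈ X) : ∃ y ∈ A, x < y ∧ W x y y₀ ≠ 0 ∧ #(between A x y) ≤ K := by
    obtain ⟨hxA, hx₂, hxK⟩ := mem_filter.mp hx
    refine exists_near_succ ((hW₂ x y₀).card_le (fun y hy => ?_) hx₂) hxK
    simpa using (mem_filter.mp hy).2
  choose! σ hσA hσlt hσW hσcard using hsucc
  have hσ : ∀ x ∈ X, x < σ x ∧ #(between A x (σ x)) ≤ K := fun x hx => ⟨hσlt x hx, hσcard x hx⟩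
  set S := A + A
  set T := image₂ f A A
  set L := 8 * (K * (K + 1)) * M / n with hL
  have hn0 : 0 < n := by omega
  have hL₁ : 8 * (K * (K + 1)) * M ≤ (L + 1) * n :=
    (Nat.lt_mul_of_div_lt (Nat.lt_succ_self _) hn0).le
  have hL₂ : L * n ≤ 8 * (K * (K + 1)) * M := Nat.div_mul_le_self _ _
  have hKK : 0 < K * (K + 1) := by positivity
  have hL₃ : 1 ≤ L := by
    rw [hL, Nat.one_le_div_iff hn0]
    nlinarith
  set U := (A ×ˢ A) ×ˢ X with hU
  set B₁ := {z ∈ U | W z.2 (σ z.2) z.1.2 = 0} with hB₁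
  set B₂ := {z ∈ U | L < #(between S (z.1.1 + z.2) (z.1.1 + σ z.2))} with hB₂
  set B₃ := {z ∈ U | L < #(between T (f z.2 z.1.2) (f (σ z.2) z.1.2))} with hB₃
  set G := {z ∈ U | W z.2 (σ z.2) z.1.2 ≠ 0 ∧ #(between S (z.1.1 + z.2) (z.1.1 + σ z.2)) ≤ L ∧
    #(between T (f z.2 z.1.2) (f (σ z.2) z.1.2)) ≤ L} with hG
  have hUcard : #U = n * n * #X := by simp [hU, card_product, hn]
  have hsplit : #U ≤ #G + (#B₁ + (#B₂ + #B₃)) := by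
    have hsub : U ⊆ G ∪ (B₁ ∪ (B₂ ∪ B₃)) := by
      intro z hz
      simp only [hG, hB₁, hB₂, hB₃, mem_union, mem_filter, hz, true_and]
      rw [← not_lt, ← not_lt]
      tauto
    refine (card_le_card hsub).trans ((card_union_le _ _).trans (Nat.add_le_add_left ?_ _))
    exact (card_union_le _ _).trans (Nat.add_le_add_left (card_union_le _ _) _)
  have hB₁card : #B₁ ≤ n * n * (2 * K) := by
    have h := card_filter_product_le (A ×ˢ X) A (fun p b => W p.2 (σ p.2) b = 0) (C := K + K)
      fun p hp => by
        have hpX := (mem_product.mp hp).2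
        exact (hW₃ p.2 (σ p.2)).card_le (fun b hb => (mem_filter.mp hb).2) (hσW p.2 hpX)
    calc #B₁ ≤ #{z ∈ (A ×ˢ X) ×ˢ A | W z.1.2 (σ z.1.2) z.2 = 0} := by
          refine card_le_card_of_injOn (fun z => ((z.1.1, z.2), z.1.2)) ?_ ?_
          · rintro ⟨⟨a, b⟩, x⟩ hz
            simp only [hB₁, hU, coe_filter, mem_product, Set.mem_ofPred_eq] at hz ⊢
            tauto
          · rintro ⟨⟨a, b⟩, x⟩ _ ⟨⟨a', b'⟩, x'⟩ _ h
            simp only [Prod.mk.injEq] at h ⊢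
            tauto
      _ ≤ n * #X * (K + K) := by simpa [card_product] using h
      _ ≤ n * n * (2 * K) := by
        rw [two_mul]
        exact Nat.mul_le_mul_right _ (Nat.mul_le_mul_left _ (card_le_card hXA))
  have markov (h : (ℝ × ℝ) × ℝ → ℕ)
      (hh : ∀ p ∈ A ×ˢ A, ∑ x ∈ X, h (p, x) ≤ M * (K * (K + 1))) :
      #{z ∈ U | L < h z} * 8 ≤ n * n * n := by
    have h₁ := card_filter_lt_mul_le U h L
    have h₂ : ∑ z ∈ U, h z ≤ n * n * (M * (K * (K + 1))) := by
      rw [hU, sum_product]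
      simpa [card_product] using sum_le_card_nsmul _ _ _ hh
    have hpos : 0 < M * (K * (K + 1)) := Nat.mul_pos (by omega) hKK
    refine Nat.le_of_mul_le_mul_right ?_ hpos
    calc #{z ∈ U | L < h z} * 8 * (M * (K * (K + 1)))
        = #{z ∈ U | L < h z} * (8 * (K * (K + 1)) * M) := by ring
      _ ≤ #{z ∈ U | L < h z} * ((L + 1) * n) := Nat.mul_le_mul_left _ hL₁
      _ = #{z ∈ U | L < h z} * (L + 1) * n := by ring
      _ ≤ n * n * (M * (K * (K + 1))) * n := Nat.mul_le_mul_right _ (h₁.trans h₂)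
      _ = _ := by ring
  have hB₂card : #B₂ * 8 ≤ n * n * n := by
    refine markov (fun z => #(between S (z.1.1 + z.2) (z.1.1 + σ z.2))) fun p _ => ?_
    have hg : IsPolyFun K fun x => p.1 + x :=
      (((IsPolyFun.const p.1).mono K.zero_le).add (IsPolyFun.id.mono hK))
    exact (sum_card_between_le hg S hXA hσ).trans (Nat.mul_le_mul_right _ hS)
  have hB₃card : #B₃ * 8 ≤ n * n * n := by
    refine markov (fun z => #(between T (f z.2 z.1.2) (f (σ z.2) z.1.2))) fun p _ => ?_
    exact (sum_card_between_le (hf p.2) T hXA hσ).trans (Nat.mul_le_mul_right _ hT)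
  have hGcard : #G ≤ D * ((M * (2 * L + 3)) * (M * (2 * L + 3))) := by
    have h := card_le_mul_card_image_of_maps_to (s := G)
      (f := fun z => ((z.1.1 + z.2, z.1.1 + σ z.2), (f z.2 z.1.2, f (σ z.2) z.1.2)))
      (t := {p ∈ S ×ˢ S | #(between S p.1 p.2) ≤ L} ×ˢ {p ∈ T ×ˢ T | #(between T p.1 p.2) ≤ L})
      (by
        rintro ⟨⟨a, b⟩, x⟩ hz
        simp only [hG, hU, mem_filter, mem_product] at hz
        obtain ⟨⟨⟨ha, hb⟩, hx⟩, -, h₁, h₂⟩ := hz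
        simp only [mem_product, mem_filter]
        exact ⟨⟨⟨add_mem_add ha (hXA hx), add_mem_add ha (hσA x hx)⟩, h₁⟩,
          ⟨mem_image₂_of_mem (hXA hx) hb, mem_image₂_of_mem (hσA x hx) hb⟩, h₂⟩)
      D (by
        rintro ⟨⟨s, s'⟩, ⟨t, t'⟩⟩ -
        set Y := {z ∈ G | ((z.1.1 + z.2, z.1.1 + σ z.2), (f z.2 z.1.2, f (σ z.2) z.1.2)) =
          ((s, s'), (t, t'))} with hY
        have hYmem : ∀ z ∈ Y, W z.2 (σ z.2) z.1.2 ≠ 0 ∧ z.1.1 + z.2 = s ∧ z.1.1 + σ z.2 = s' ∧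
            f z.2 z.1.2 = t ∧ f (σ z.2) z.1.2 = t' := by
          intro z hz
          simp only [hY, hG, mem_filter, Prod.mk.injEq] at hz
          tauto
        have hinj : Set.InjOn (fun z : (ℝ × ℝ) × ℝ => (z.2, z.1.2)) Y := by
          rintro ⟨⟨a, b⟩, x⟩ hz ⟨⟨a', b'⟩, x'⟩ hz' h
          have h₁ := (hYmem _ hz).2.1
          have h₂ := (hYmem _ hz').2.1
          simp only [Prod.mk.injEq] at h h₁ h₂ ⊢
          exact ⟨⟨by linarith [h.1], h.2⟩, h.1⟩
        rw [← card_image_of_injOn hinj]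
        refine card_nonsingular_zeros_le hK (F := fun x y => f x y - t) (F₁ := f₁) (F₂ := f₂)
          (G := fun x y => f (x + (s' - s)) y - t') (G₁ := fun x y => f₁ (x + (s' - s)) y)
          (G₂ := fun x y => f₂ (x + (s' - s)) y)
          (fun y => (hf y).sub ((IsPolyFun.const t).mono (Nat.zero_le _)))
          (fun x => (hf' x).sub ((IsPolyFun.const t).mono (Nat.zero_le _)))
          (fun y => ((hf y).comp_add _).sub ((IsPolyFun.const t').mono (Nat.zero_le _)))
          (fun x => (hf' _).sub ((IsPolyFun.const t').mono (Nat.zero_le _)))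
          (fun x y v w => (hgrad x y v w).sub_const t)
          (fun x y v w => ?_) _ ?_
        · have h := (hgrad (x + (s' - s)) y v w).sub_const t'
          simpa only [add_right_comm] using h
        · intro z' hz'
          obtain ⟨z, hz, rfl⟩ := mem_image.mp hz'
          obtain ⟨h₁, h₂, h₃, h₄, h₅⟩ := hYmem z hz
          have hshift : z.2 + (s' - s) = σ z.2 := by linarith
          simp only [hshift, h₄, h₅, sub_self, true_and]
          exact h₁)
    refine h.trans (Nat.mul_le_mul_left _ ?_)
    rw [card_product]
    exact Nat.mul_le_mul
      ((card_near_pairs_le S L).trans (Nat.mul_le_mul_right _ hS))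
      ((card_near_pairs_le T L).trans (Nat.mul_le_mul_right _ hT))
  have hcube : n * n * n ≤ 2 * #G := by
    have h₁ : n * n * n ≤ n * n * #X + n * n * (2 * K + 1) := by
      rw [← mul_add]
      exact Nat.mul_le_mul_left _ hXcard
    have h₂ : n * n * (4 * (4 * K + 1)) ≤ n * n * n := Nat.mul_le_mul_left _ hlarge
    have h₃ : n * n * (4 * (4 * K + 1)) = 4 * (n * n * (2 * K + 1)) + 4 * (n * n * (2 * K)) := by
      ring
    omega
  have hLn : (2 * L + 3) * n ≤ 40 * (K * (K + 1)) * M := by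
    calc (2 * L + 3) * n ≤ (5 * L) * n := Nat.mul_le_mul_right _ (by omega)
      _ = 5 * (L * n) := by ring
      _ ≤ 5 * (8 * (K * (K + 1)) * M) := Nat.mul_le_mul_left _ hL₂
      _ = _ := by ring
  calc n ^ 5 = n * n * n * (n * n) := by ring
    _ ≤ 2 * (D * ((M * (2 * L + 3)) * (M * (2 * L + 3)))) * (n * n) :=
      Nat.mul_le_mul_right _ (hcube.trans (Nat.mul_le_mul_left _ hGcard))
    _ = 2 * D * M ^ 2 * (((2 * L + 3) * n) * ((2 * L + 3) * n)) := by ring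
    _ ≤ 2 * D * M ^ 2 * ((40 * (K * (K + 1)) * M) * (40 * (K * (K + 1)) * M)) :=
      Nat.mul_le_mul_left _ (Nat.mul_le_mul hLn hLn)
    _ = (3200 * D * (K * (K + 1)) ^ 2) * M ^ 4 := by ring
    _ ≤ _ := Nat.mul_le_mul_right _ (Nat.le_add_right _ _)

lemma MvPolynomial.totalDegree_pderiv_le {σ R : Type*} [CommSemiring R] (i : σ)
    (p : MvPolynomial σ R) : (pderiv i p).totalDegree ≤ p.totalDegree := by
  refine Finset.sup_le fun m hm => ?_
  rw [mem_support_iff, coeff_pderiv] at hm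
  have hmem : m + Finsupp.single i 1 ∈ p.support := mem_support_iff.mpr (left_ne_zero_of_mul hm)
  refine le_trans ?_ (le_totalDegree hmem)
  rw [Finsupp.sum_add_index' (fun _ => rfl) (fun _ _ _ => rfl)]
  exact Nat.le_add_right _ _

lemma eval_aeval_polynomial (g₀ g₁ : Polynomial ℝ) (p : MvPolynomial (Fin 2) ℝ) (x : ℝ) :
    (MvPolynomial.aeval ![g₀, g₁] p).eval x = MvPolynomial.eval ![g₀.eval x, g₁.eval x] p := by
  induction p using MvPolynomial.induction_on with
  | C a => simp
  | add p q hp hq => simp [hp, hq]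
  | mul_X p i hp => fin_cases i <;> simp [hp]

lemma isPolyFun_eval_left {K : ℕ} {p : MvPolynomial (Fin 2) ℝ} (hp : p.totalDegree ≤ K) (y : ℝ) :
    IsPolyFun K fun x => MvPolynomial.eval ![x, y] p := by
  refine ⟨MvPolynomial.aeval ![Polynomial.X, Polynomial.C y] p, ?_, fun x => ?_⟩
  · simpa using MvPolynomial.aeval_natDegree_le p hp ![Polynomial.X, Polynomial.C y] (n := 1)
      (by intro i; fin_cases i <;> simp)
  · simp [eval_aeval_polynomial]

lemma isPolyFun_eval_right {K : ℕ} {p : MvPolynomial (Fin 2) ℝ} (hp : p.totalDegree ≤ K) (x : ℝ) :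
    IsPolyFun K fun y => MvPolynomial.eval ![x, y] p := by
  refine ⟨MvPolynomial.aeval ![Polynomial.C x, Polynomial.X] p, ?_, fun y => ?_⟩
  · simpa using MvPolynomial.aeval_natDegree_le p hp ![Polynomial.C x, Polynomial.X] (n := 1)
      (by intro i; fin_cases i <;> simp)
  · simp [eval_aeval_polynomial]

lemma hasGradient_eval (p : MvPolynomial (Fin 2) ℝ) :
    HasGradient (fun x y => MvPolynomial.eval ![x, y] p)
      (fun x y => MvPolynomial.eval ![x, y] (MvPolynomial.pderiv 0 p))
      (fun x y => MvPolynomial.eval ![x, y] (MvPolynomial.pderiv 1 p)) := by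
  intro x y v w
  have hlin (a b : ℝ) : HasDerivAt (fun ε : ℝ => a + ε * b) b 0 := by
    simpa using ((hasDerivAt_id (0 : ℝ)).mul_const b).const_add a
  induction p using MvPolynomial.induction_on with
  | C a => simpa using hasDerivAt_const (0 : ℝ) a
  | add p q hp hq =>
    simp only [map_add]
    exact (hp.add hq).congr_deriv (by ring)
  | mul_X p i hp =>
    fin_cases i
    · simp only [Fin.zero_eta, map_mul, MvPolynomial.eval_X, Matrix.cons_val_zero]
      refine (hp.mul (hlin x v)).congr_deriv ?_
      simp [Derivation.leibniz, MvPolynomial.pderiv_X]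
      ring
    · simp only [Fin.mk_one, map_mul, MvPolynomial.eval_X, Matrix.cons_val_one]
      refine (hp.mul (hlin y w)).congr_deriv ?_
      simp [Derivation.leibniz, MvPolynomial.pderiv_X]
      ring

lemma HasGradient.eq_of_directional_eq_zero {F F₁ F₂ : ℝ → ℝ → ℝ} (h : HasGradient F F₁ F₂)
    {v w : ℝ} (h0 : ∀ x y, v * F₁ x y + w * F₂ x y = 0) (x y ε : ℝ) :
    F (x + ε * v) (y + ε * w) = F x y := by
  have hd (s : ℝ) : HasDerivAt (fun ε => F (x + ε * v) (y + ε * w)) 0 s := by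
    have h1 := h (x + s * v) (y + s * w) v w
    rw [h0] at h1
    have h2 := HasDerivAt.comp_sub_const s s (by rwa [sub_self])
    refine h2.congr_of_eventuallyEq (Filter.Eventually.of_forall fun ε => ?_)
    dsimp only
    congr 1 <;> ring
  have h3 := is_const_of_deriv_eq_zero (fun s => (hd s).differentiableAt) (fun s => (hd s).deriv) ε 0
  simpa using h3

lemma isDegenerate_of_parallel_gradient {f : MvPolynomial (Fin 2) ℝ} {p q : ℝ}
    (hpq : p ≠ 0 ∨ q ≠ 0)
    (h : ∀ x y, q * MvPolynomial.eval ![x, y] (MvPolynomial.pderiv 0 f) =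
      p * MvPolynomial.eval ![x, y] (MvPolynomial.pderiv 1 f)) : IsDegenerate f := by
  have hN : p ^ 2 + q ^ 2 ≠ 0 := by
    rcases hpq with h | h <;> positivity
  refine ⟨MvPolynomial.aeval ![Polynomial.C (p / (p ^ 2 + q ^ 2)) * Polynomial.X,
    Polynomial.C (q / (p ^ 2 + q ^ 2)) * Polynomial.X] f, p, q, fun x y => ?_⟩
  have hline := (hasGradient_eval f).eq_of_directional_eq_zero (v := q) (w := -p)
    (fun x y => by linarith [h x y]) x y ((p * y - q * x) / (p ^ 2 + q ^ 2))
  rw [eval_aeval_polynomial, ← hline]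
  simp only [Polynomial.eval_mul, Polynomial.eval_C, Polynomial.eval_X]
  congr 3
  · field_simp
    ring
  · congr 1
    field_simp
    ring

lemma IsPolyFun.eq_zero_of_mul_eq_zero {K L : ℕ} {g h : ℝ → ℝ} (hg : IsPolyFun K g)
    (hh : IsPolyFun L h) (hgh : ∀ x, g x * h x = 0) {z : ℝ} (hz : h z ≠ 0) (x : ℝ) :
    g x = 0 := by
  obtain ⟨P, -, hP⟩ := hg
  obtain ⟨Q, -, hQ⟩ := hh
  have hPQ : P * Q = 0 := Polynomial.funext fun x => by simp [← hP, ← hQ, hgh]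
  rcases mul_eq_zero.mp hPQ with h | h
  · simp [hP, h]
  · exact absurd (by simp [hQ, h]) hz

lemma exists_jacobian_ne_zero {f : MvPolynomial (Fin 2) ℝ} (hf : ¬ IsDegenerate f)
    {f₁ f₂ : ℝ → ℝ → ℝ}
    (hf₁ : f₁ = fun x y => MvPolynomial.eval ![x, y] (MvPolynomial.pderiv 0 f))
    (hf₂ : f₂ = fun x y => MvPolynomial.eval ![x, y] (MvPolynomial.pderiv 1 f)) :
    (∃ x x' y, f₁ x y * f₂ x' y - f₂ x y * f₁ x' y ≠ 0) ∨
      ∃ x y y', f₂ x y * f₁ x y' - f₁ x y * f₂ x y' ≠ 0 := by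
  by_contra! hW
  obtain ⟨hW₁, hW₂⟩ := hW
  apply hf
  by_cases h0 : ∃ x y, f₁ x y ≠ 0 ∨ f₂ x y ≠ 0
  · obtain ⟨x₀, y₀, hpq⟩ := h0
    refine isDegenerate_of_parallel_gradient hpq fun x y => ?_
    have hp₁ (y : ℝ) : IsPolyFun f.totalDegree fun x => f₁ x y := by
      rw [hf₁]; exact isPolyFun_eval_left (MvPolynomial.totalDegree_pderiv_le 0 f) y
    have hp₂ (y : ℝ) : IsPolyFun f.totalDegree fun x => f₂ x y := by
      rw [hf₂]; exact isPolyFun_eval_left (MvPolynomial.totalDegree_pderiv_le 1 f) y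
    have hh := ((IsPolyFun.const (f₂ x₀ y₀)).mul (hp₁ y)).sub
      ((IsPolyFun.const (f₁ x₀ y₀)).mul (hp₂ y))
    have key : f₂ x₀ y₀ * f₁ x y - f₁ x₀ y₀ * f₂ x y = 0 := by
      rcases hpq with h | h
      · refine hh.eq_zero_of_mul_eq_zero (hp₁ y₀) (fun x => ?_) h x
        linear_combination f₁ x y * hW₁ x x₀ y₀ - f₁ x₀ y₀ * hW₂ x y y₀
      · refine hh.eq_zero_of_mul_eq_zero (hp₂ y₀) (fun x => ?_) h x
        linear_combination f₂ x y * hW₁ x x₀ y₀ - f₂ x₀ y₀ * hW₂ x y y₀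
    rw [hf₁, hf₂] at key
    rw [hf₁, hf₂]
    linarith
  · push Not at h0
    rw [hf₁, hf₂] at h0
    exact isDegenerate_of_parallel_gradient (p := 1) (q := 0) (by simp)
      fun x y => by simp [(h0 x y).2]

lemma card_pow_five_le {K : ℕ} (hK : 1 ≤ K) {f : MvPolynomial (Fin 2) ℝ}
    (hdeg : f.totalDegree ≤ K) (hf : ¬ IsDegenerate f) {A : Finset ℝ} {M : ℕ}
    (hS : #(A + A) ≤ M) (hT : #(image₂ (fun a b => MvPolynomial.eval ![a, b] f) A A) ≤ M) :
    #A ^ 5 ≤ (3200 * (K * (16 * K + 1)) ^ 2 * (K * (K + 1)) ^ 2 + 4 * (4 * K + 1)) * M ^ 4 := by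
  have h₁ := (MvPolynomial.totalDegree_pderiv_le 0 f).trans hdeg
  have h₂ := (MvPolynomial.totalDegree_pderiv_le 1 f).trans hdeg
  rcases exists_jacobian_ne_zero hf rfl rfl with ⟨x, x', y, hW⟩ | ⟨x, y, y', hW⟩
  · exact card_pow_five_le_of_jacobian_ne_zero hK (isPolyFun_eval_left hdeg)
      (isPolyFun_eval_right hdeg) (isPolyFun_eval_left h₁) (isPolyFun_eval_right h₁)
      (isPolyFun_eval_left h₂) (isPolyFun_eval_right h₂) (hasGradient_eval f) hW hS hT
  · rw [image₂_swap] at hT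
    exact card_pow_five_le_of_jacobian_ne_zero hK (isPolyFun_eval_right hdeg)
      (isPolyFun_eval_left hdeg) (isPolyFun_eval_right h₂) (isPolyFun_eval_left h₂)
      (isPolyFun_eval_right h₁) (isPolyFun_eval_left h₁) (hasGradient_eval f).swap hW hS hT

/-- For a non-degenerate `f` of total degree `k ≥ 2` there is `c > 0` depending only
on `k` with `max(|A+A|, |f(A,A)|) ≥ c·|A|^{5/4}` for every finite `A ⊆ ℝ`. -/
theorem max_sum_expander_bound (k : ℕ) (hk : 2 ≤ k) :
    ∃ c : ℝ, 0 < c ∧ ∀ f : MvPolynomial (Fin 2) ℝ,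
      f.totalDegree = k → ¬ IsDegenerate f →
      ∀ A : Finset ℝ,
        c * (A.card : ℝ) ^ ((5 : ℝ) / 4) ≤
          max ((A + A).card : ℝ)
            ((Finset.image₂ (fun a b => MvPolynomial.eval ![a, b] f) A A).card : ℝ) := by
  set C : ℕ := 3200 * (k * (16 * k + 1)) ^ 2 * (k * (k + 1)) ^ 2 + 4 * (4 * k + 1) with hC
  have hC0 : (0 : ℝ) < C := by exact_mod_cast Nat.add_pos_right _ (by omega)
  refine ⟨((C : ℝ)⁻¹) ^ ((1 : ℝ) / 4), by positivity, fun f hdeg hf A => ?_⟩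
  set M := max #(A + A) #(image₂ (fun a b => MvPolynomial.eval ![a, b] f) A A) with hM
  have h : #A ^ 5 ≤ C * M ^ 4 :=
    card_pow_five_le (by omega) hdeg.le hf (le_max_left _ _) (le_max_right _ _)
  have hreal : ((#A : ℝ)) ^ 5 ≤ C * (M : ℝ) ^ 4 := by exact_mod_cast h
  rw [← Nat.cast_max, ← hM]
  have hpow : (#A : ℝ) ^ ((5 : ℝ) / 4) = ((#A : ℝ) ^ 5) ^ ((1 : ℝ) / 4) := by
    rw [← Real.rpow_natCast, ← Real.rpow_mul (Nat.cast_nonneg _)]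
    norm_num
  rw [hpow, ← Real.mul_rpow (by positivity) (by positivity)]
  calc ((C : ℝ)⁻¹ * (#A : ℝ) ^ 5) ^ ((1 : ℝ) / 4) ≤ ((M : ℝ) ^ 4) ^ ((1 : ℝ) / 4) := by
        refine Real.rpow_le_rpow (by positivity) ?_ (by norm_num)
        rwa [inv_mul_le_iff₀ hC0]
    _ = (M : ℝ) := by
        rw [← Real.rpow_natCast, ← Real.rpow_mul (Nat.cast_nonneg _)]
        norm_num
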